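/- For Newtonian space-time data (with τ ≠ 0): the formula s · [(u,x,α)] = [(u,x,α + s·τ)] defines a well-defined free action of the additive group (ℝ,+) on P, and the map μ : P → P₀, [(u,x,α)] ↦ [(u,x,α|_{V₀})], is surjective with fibers exactly the ℝ-orbits: μ(p) = μ(p') if and only if p' = s · p for some s ∈ ℝ. (This is the set-theoretic content of the assertion that μ : P → P₀ is a principal ℝ-bundle with principal action ψ(s,[u,x,α]) = [u,x,α+sτ].) -/

import Mathlib

/-- The functional `σ(u,u') ∈ V*` of Newtonian space-time data. -/
noncomputable def nsigma {V : Type*} [AddCommGroup V] [Module ℝ V]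
    (τ : V →ₗ[ℝ] ℝ)
    (g : LinearMap.ker τ →ₗ[ℝ] LinearMap.ker τ →ₗ[ℝ] ℝ)
    (u u' : {v : V // τ v = 1}) (v : V) : ℝ :=
  g ⟨u.1 - u'.1, by
      simp only [LinearMap.mem_ker, map_sub, u.2, u'.2]; ring⟩
    ⟨v - (τ v / 2) • (u.1 + u'.1), by
      simp only [LinearMap.mem_ker, map_sub, map_smul, map_add, u.2, u'.2, smul_eq_mul]; ring⟩

/-- The relation `∼` on `V₁ × E × V*`. -/
noncomputable def nrel {V : Type*} [AddCommGroup V] [Module ℝ V] (E : Type*)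
    (τ : V →ₗ[ℝ] ℝ)
    (g : LinearMap.ker τ →ₗ[ℝ] LinearMap.ker τ →ₗ[ℝ] ℝ) (m : ℝ) :
    ({v : V // τ v = 1} × E × (V →ₗ[ℝ] ℝ)) →
      ({v : V // τ v = 1} × E × (V →ₗ[ℝ] ℝ)) → Prop :=
  fun p q => p.2.1 = q.2.1 ∧ ∀ v : V, q.2.2 v = p.2.2 v + m * nsigma τ g p.1 q.1 v

/-- The relation `∼₀` on `V₁ × E × V₀*`. -/
noncomputable def nrel0 {V : Type*} [AddCommGroup V] [Module ℝ V] (E : Type*)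
    (τ : V →ₗ[ℝ] ℝ)
    (g : LinearMap.ker τ →ₗ[ℝ] LinearMap.ker τ →ₗ[ℝ] ℝ) (m : ℝ) :
    ({v : V // τ v = 1} × E × (LinearMap.ker τ →ₗ[ℝ] ℝ)) →
      ({v : V // τ v = 1} × E × (LinearMap.ker τ →ₗ[ℝ] ℝ)) → Prop :=
  fun p q => p.2.1 = q.2.1 ∧
    ∀ w : LinearMap.ker τ,
      q.2.2 w = p.2.2 w +
        m * g ⟨p.1.1 - q.1.1, by
          simp only [LinearMap.mem_ker, map_sub, p.1.2, q.1.2]; ring⟩ w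

/-- Restriction `(u,x,α) ↦ (u,x,α|_{V₀})`. -/
def nrestr {V : Type*} [AddCommGroup V] [Module ℝ V] (E : Type*)
    (τ : V →ₗ[ℝ] ℝ)
    (p : {v : V // τ v = 1} × E × (V →ₗ[ℝ] ℝ)) :
    {v : V // τ v = 1} × E × (LinearMap.ker τ →ₗ[ℝ] ℝ) :=
  (p.1, p.2.1, p.2.2 ∘ₗ (LinearMap.ker τ).subtype)

/-- The shift `(u,x,α) ↦ (u,x,α + s·τ)`. -/
noncomputable def nshift {V : Type*} [AddCommGroup V] [Module ℝ V] (E : Type*)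
    (τ : V →ₗ[ℝ] ℝ) (s : ℝ)
    (p : {v : V // τ v = 1} × E × (V →ₗ[ℝ] ℝ)) :
    {v : V // τ v = 1} × E × (V →ₗ[ℝ] ℝ) :=
  (p.1, p.2.1, p.2.2 + s • τ)

section

variable {V : Type*} [AddCommGroup V] [Module ℝ V] {E : Type*} {τ : V →ₗ[ℝ] ℝ}

/-- The difference of two elements of `V₁`, as an element of `V₀`. -/
def velocityDiff (u u' : {v : V // τ v = 1}) : LinearMap.ker τ :=
  ⟨u.1 - u'.1, by simp [u.2, u'.2]⟩

/-- The projection of `V` onto `V₀` along `u ∈ V₁`. -/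
def projAlong (u : {v : V // τ v = 1}) : V →ₗ[ℝ] LinearMap.ker τ :=
  (LinearMap.id - τ.smulRight u.1).codRestrict _ fun v => by simp [u.2]

@[simp]
theorem coe_projAlong (u : {v : V // τ v = 1}) (v : V) :
    (projAlong u v : V) = v - τ v • u.1 := rfl

theorem projAlong_of_mem_ker (u : {v : V // τ v = 1}) (w : LinearMap.ker τ) :
    projAlong u w.1 = w := by
  ext
  simp [LinearMap.mem_ker.1 w.2]

theorem velocityDiff_add (u u' u'' : {v : V // τ v = 1}) :
    velocityDiff u u' + velocityDiff u' u'' = velocityDiff u u'' := by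
  ext
  simp [velocityDiff]

@[simp]
theorem velocityDiff_self (u : {v : V // τ v = 1}) : velocityDiff u u = 0 := by
  ext
  simp [velocityDiff]

theorem velocityDiff_swap (u u' : {v : V // τ v = 1}) :
    velocityDiff u' u = -velocityDiff u u' := by
  ext
  simp [velocityDiff]

variable {g : LinearMap.ker τ →ₗ[ℝ] LinearMap.ker τ →ₗ[ℝ] ℝ} {m : ℝ}

theorem nsigma_eq_left (u u' : {v : V // τ v = 1}) (v : V) :
    nsigma τ g u u' v = g (velocityDiff u u') (projAlong u v)
      + τ v / 2 * g (velocityDiff u u') (velocityDiff u u') := by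
  rw [← smul_eq_mul, ← map_smul, ← map_add]
  unfold nsigma velocityDiff
  congr 1
  ext
  simp only [Submodule.coe_add, Submodule.coe_smul, coe_projAlong]
  module

theorem nsigma_eq_right (u u' : {v : V // τ v = 1}) (v : V) :
    nsigma τ g u u' v = g (velocityDiff u u') (projAlong u' v)
      - τ v / 2 * g (velocityDiff u u') (velocityDiff u u') := by
  rw [← smul_eq_mul, ← map_smul, ← map_sub]
  unfold nsigma velocityDiff
  congr 1
  ext
  simp only [Submodule.coe_sub, Submodule.coe_smul, coe_projAlong]
  module

theorem nsigma_of_mem_ker (u u' : {v : V // τ v = 1}) (w : LinearMap.ker τ) :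
    nsigma τ g u u' w.1 = g (velocityDiff u u') w := by
  simp [nsigma_eq_left, projAlong_of_mem_ker, LinearMap.mem_ker.1 w.2]

@[simp]
theorem nsigma_self (u : {v : V // τ v = 1}) (v : V) : nsigma τ g u u v = 0 := by
  simp [nsigma_eq_left]

theorem nsigma_swap (u u' : {v : V // τ v = 1}) (v : V) :
    nsigma τ g u' u v = -nsigma τ g u u' v := by
  rw [nsigma_eq_right u', nsigma_eq_left u, velocityDiff_swap u u']
  simp only [map_neg, LinearMap.neg_apply]
  ring

theorem nsigma_add (hsymm : ∀ x y : LinearMap.ker τ, g x y = g y x)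
    (u u' u'' : {v : V // τ v = 1}) (v : V) :
    nsigma τ g u u' v + nsigma τ g u' u'' v = nsigma τ g u u'' v := by
  have hproj : projAlong u' v = projAlong u v + τ v • velocityDiff u u' := by
    ext
    simp only [Submodule.coe_add, Submodule.coe_smul, coe_projAlong, velocityDiff]
    module
  simp only [nsigma_eq_left, ← velocityDiff_add u u' u'', hproj, map_add, map_smul,
    LinearMap.add_apply, smul_eq_mul, hsymm (velocityDiff u' u'') (velocityDiff u u')]
  ring

theorem nrel_equivalence (hsymm : ∀ x y : LinearMap.ker τ, g x y = g y x) :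
    Equivalence (nrel E τ g m) where
  refl p := ⟨rfl, fun v => by simp⟩
  symm h := ⟨h.1.symm, fun v => by rw [h.2 v, nsigma_swap]; ring⟩
  trans {p q r} h h' := ⟨h.1.trans h'.1, fun v => by
    rw [h'.2 v, h.2 v, ← nsigma_add hsymm p.1 q.1 r.1]; ring⟩

theorem nrel0_iff {p q : {v : V // τ v = 1} × E × (LinearMap.ker τ →ₗ[ℝ] ℝ)} :
    nrel0 E τ g m p q ↔ p.2.1 = q.2.1 ∧
      ∀ w, q.2.2 w = p.2.2 w + m * g (velocityDiff p.1 q.1) w := Iff.rfl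

theorem nrel0_equivalence : Equivalence (nrel0 E τ g m) where
  refl p := nrel0_iff.2 ⟨rfl, fun w => by simp⟩
  symm {p q} h := nrel0_iff.2 ⟨h.1.symm, fun w => by
    rw [(nrel0_iff.1 h).2 w, velocityDiff_swap p.1 q.1, map_neg, LinearMap.neg_apply]; ring⟩
  trans {p q r} h h' := nrel0_iff.2 ⟨h.1.trans h'.1, fun w => by
    rw [(nrel0_iff.1 h').2 w, (nrel0_iff.1 h).2 w, ← velocityDiff_add p.1 q.1 r.1, map_add,
      LinearMap.add_apply]
    ring⟩

theorem quot_mk_eq_iff {α : Type*} {r : α → α → Prop} (hr : Equivalence r) {a b : α} :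
    Quot.mk r a = Quot.mk r b ↔ r a b :=
  ⟨fun h => hr.eqvGen_iff.1 (Quot.eqvGen_exact h), fun h => Quot.sound h⟩

theorem nrel_nshift {p q : {v : V // τ v = 1} × E × (V →ₗ[ℝ] ℝ)} (s : ℝ)
    (h : nrel E τ g m p q) : nrel E τ g m (nshift E τ s p) (nshift E τ s q) :=
  ⟨h.1, fun v => by
    simp only [nshift, LinearMap.add_apply, h.2 v]
    ring⟩

theorem eq_zero_of_nrel_nshift_self {p : {v : V // τ v = 1} × E × (V →ₗ[ℝ] ℝ)} {s : ℝ}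
    (h : nrel E τ g m (nshift E τ s p) p) : s = 0 := by
  simpa [nshift, p.1.2] using h.2 p.1.1

theorem nrestr_surjective : Function.Surjective (nrestr E τ) := by
  rintro ⟨u, x, a⟩
  refine ⟨(u, x, a ∘ₗ projAlong u), ?_⟩
  simp only [nrestr, Prod.mk.injEq, true_and]
  ext w
  simp [projAlong_of_mem_ker]

theorem nrel0_nrestr_iff {p q : {v : V // τ v = 1} × E × (V →ₗ[ℝ] ℝ)} :
    nrel0 E τ g m (nrestr E τ p) (nrestr E τ q) ↔
      ∃ s : ℝ, nrel E τ g m (nshift E τ s p) q := by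
  obtain ⟨u, x, a⟩ := p
  obtain ⟨u', x', a'⟩ := q
  simp only [nrel0_iff, nrel, nrestr, nshift, LinearMap.comp_apply, Submodule.subtype_apply,
    LinearMap.add_apply, LinearMap.smul_apply, smul_eq_mul]
  constructor
  · rintro ⟨hx, h⟩
    refine ⟨a' u.1 - a u.1 - m / 2 * g (velocityDiff u u') (velocityDiff u u'), hx, fun v => ?_⟩
    have hv := h (projAlong u v)
    simp only [coe_projAlong, map_sub, map_smul, smul_eq_mul] at hv
    rw [nsigma_eq_left]
    linear_combination hv
  · rintro ⟨s, hx, h⟩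
    refine ⟨hx, fun w => ?_⟩
    rw [h w.1, nsigma_of_mem_ker, LinearMap.mem_ker.1 w.2, mul_zero, add_zero]

end

/-- For Newtonian space-time data (with `τ ≠ 0`):
`s · [(u,x,α)] = [(u,x,α + s·τ)]` is a well-defined free action of `(ℝ,+)` on
`P = (V₁ × E × V*)/∼`, and the map `μ : P → P₀`, `[(u,x,α)] ↦ [(u,x,α|_{V₀})]`,
is surjective with fibers exactly the `ℝ`-orbits; i.e. `μ : P → P₀` is a
set-theoretic principal `ℝ`-bundle. -/
theorem stmt_14 {V : Type*} [AddCommGroup V] [Module ℝ V] (E : Type*) [Nonempty E]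
    (τ : V →ₗ[ℝ] ℝ) (hτ : τ ≠ 0)
    (g : LinearMap.ker τ →ₗ[ℝ] LinearMap.ker τ →ₗ[ℝ] ℝ)
    (hsymm : ∀ x y : LinearMap.ker τ, g x y = g y x) (m : ℝ) :
    (∃! act : ℝ → Quot (nrel E τ g m) → Quot (nrel E τ g m),
      ∀ (s : ℝ) (p : {v : V // τ v = 1} × E × (V →ₗ[ℝ] ℝ)),
        act s (Quot.mk _ p) = Quot.mk _ (nshift E τ s p)) ∧
    ∀ (act : ℝ → Quot (nrel E τ g m) → Quot (nrel E τ g m))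
      (μmap : Quot (nrel E τ g m) → Quot (nrel0 E τ g m)),
      (∀ (s : ℝ) (p : {v : V // τ v = 1} × E × (V →ₗ[ℝ] ℝ)),
        act s (Quot.mk _ p) = Quot.mk _ (nshift E τ s p)) →
      (∀ p : {v : V // τ v = 1} × E × (V →ₗ[ℝ] ℝ),
        μmap (Quot.mk _ p) = Quot.mk _ (nrestr E τ p)) →
      (∀ x, act 0 x = x) ∧
      (∀ (s t : ℝ) (x : Quot (nrel E τ g m)), act (s + t) x = act s (act t x)) ∧
      (∀ (s : ℝ) (x : Quot (nrel E τ g m)), act s x = x → s = 0) ∧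
      Function.Surjective μmap ∧
      (∀ x y : Quot (nrel E τ g m), μmap x = μmap y ↔ ∃ s : ℝ, y = act s x) := by
  have hr := nrel_equivalence (E := E) (m := m) hsymm
  refine ⟨⟨fun s => Quot.map (nshift E τ s) fun _ _ => nrel_nshift s, fun _ _ => rfl, ?_⟩, ?_⟩
  · intro act h
    funext s x
    induction x using Quot.ind with | mk p => exact h s p
  · intro act μmap hact hμ
    refine ⟨?_, ?_, ?_, ?_, ?_⟩
    · rintro ⟨p⟩
      simp [hact, nshift]
    · rintro s t ⟨p⟩
      simp only [hact, nshift, add_smul, add_assoc, add_comm (s • τ)]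
    · rintro s ⟨p⟩ h
      rw [hact, quot_mk_eq_iff hr] at h
      exact eq_zero_of_nrel_nshift_self h
    · rintro ⟨q⟩
      obtain ⟨p, rfl⟩ := nrestr_surjective q
      exact ⟨Quot.mk _ p, hμ p⟩
    · rintro ⟨p⟩ ⟨q⟩
      rw [hμ, hμ, quot_mk_eq_iff nrel0_equivalence, nrel0_nrestr_iff]
      simp only [hact, eq_comm (a := Quot.mk _ q), quot_mk_eq_iff hr]
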